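/- Consider the three maps g₀, g₁, g₃ : ℝ → ℝ given by g₀(x) = x/3, g₁(x) = x/3 + 1, g₃(x) = x/3 + 3, indexed by the letters 0, 1, 3. Call a word w = w₁⋯wₙ over the alphabet {0, 1, 3} reduced if it contains no index i with wᵢ = 1 and wᵢ₊₁ = 0 (no factor '10'). Then for every n, the map sending a word w₁⋯wₙ to the composition g_{w₁} ∘ g_{w₂} ∘ ⋯ ∘ g_{wₙ} restricts to a bijection from the set of reduced words of length n onto the set of all compositions of n maps from {g₀, g₁, g₃}. In particular the reduced words form a set of unique representatives for the semigroup. -/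

import Mathlib

/-- The affine map `x ↦ x/3 + i` on `ℝ` associated to the digit `i` (for digits
`i ∈ {0, 1, 3}` these are the three generators `g₀, g₁, g₃`). -/
noncomputable def digitMap (i : ℕ) : ℝ → ℝ := fun x => x / 3 + i

/-- The composition `g_{w₁} ∘ g_{w₂} ∘ ⋯ ∘ g_{wₙ}` represented by a word `w`. -/
noncomputable def evalWord (w : List ℕ) : ℝ → ℝ := (w.map digitMap).foldr (· ∘ ·) id

theorem evalWord_cons (a : ℕ) (w : List ℕ) : evalWord (a :: w) = digitMap a ∘ evalWord w := rfl

theorem digitMap_one_comp_digitMap_zero : digitMap 1 ∘ digitMap 0 = digitMap 0 ∘ digitMap 3 := by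
  funext x
  simp only [digitMap, Function.comp_apply]
  push_cast
  ring

theorem evalWord_one_zero_append (w : List ℕ) :
    evalWord (1 :: 0 :: w) = evalWord (0 :: 3 :: w) := by
  simp only [evalWord_cons, ← Function.comp_assoc, digitMap_one_comp_digitMap_zero]

theorem evalWord_apply (w : List ℕ) (x : ℝ) :
    evalWord w x = (x + 3 * (Nat.ofDigits 3 w.reverse : ℕ)) / 3 ^ w.length := by
  induction w with
  | nil => simp [evalWord]
  | cons a w ih =>
    rw [evalWord_cons, Function.comp_apply, ih, digitMap, List.reverse_cons, Nat.ofDigits_append]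
    simp only [List.length_reverse, List.length_cons, Nat.ofDigits_singleton]
    push_cast
    field_simp
    ring

/-- Base-`3` expansions, least significant digit first, with digits in `{0, 1, 3}` and no
factor `01` are determined by their length and value. -/
theorem eq_of_ofDigits_three_eq {r s : List ℕ} (hlen : r.length = s.length)
    (hr : ∀ i ∈ r, i ∈ ({0, 1, 3} : Set ℕ)) (hs : ∀ i ∈ s, i ∈ ({0, 1, 3} : Set ℕ))
    (hr' : ¬ [0, 1] <:+: r) (hs' : ¬ [0, 1] <:+: s)
    (h : Nat.ofDigits 3 r = Nat.ofDigits 3 s) : r = s := by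
  have not_succ : ∀ {u v : List ℕ}, u.length = v.length →
      (∀ i ∈ u, i ∈ ({0, 1, 3} : Set ℕ)) → (∀ i ∈ v, i ∈ ({0, 1, 3} : Set ℕ)) →
      ¬ [0, 1] <:+: 0 :: u → Nat.ofDigits 3 u ≠ Nat.ofDigits 3 v + 1 := by
    intro u v hl hu hv h01 he
    cases u with
    | nil => simp_all
    | cons a u =>
      cases v with
      | nil => simp at hl
      | cons b v =>
        have ha := hu a (by simp)
        have hb := hv b (by simp)
        have ha1 : a ≠ 1 := by
          rintro rfl
          exact h01 ⟨[], u, rfl⟩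
        simp only [Nat.ofDigits_cons] at he
        simp only [Set.mem_insert_iff, Set.mem_singleton_iff] at ha hb
        omega
  induction r generalizing s with
  | nil => exact (List.length_eq_zero_iff.1 hlen.symm).symm
  | cons a r ih =>
    cases s with
    | nil => simp at hlen
    | cons b s =>
      have hl : r.length = s.length := by simpa using hlen
      have ha := hr a (by simp)
      have hb := hs b (by simp)
      have hr₁ : ∀ i ∈ r, i ∈ ({0, 1, 3} : Set ℕ) := fun i hi => hr i (by simp [hi])
      have hs₁ : ∀ i ∈ s, i ∈ ({0, 1, 3} : Set ℕ) := fun i hi => hs i (by simp [hi])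
      simp only [Nat.ofDigits_cons] at h
      simp only [Set.mem_insert_iff, Set.mem_singleton_iff] at ha hb
      have hab : a = b := by
        by_contra hne
        obtain ⟨rfl, rfl⟩ | ⟨rfl, rfl⟩ : a = 0 ∧ b = 3 ∨ a = 3 ∧ b = 0 := by omega
        · exact not_succ hl hr₁ hs₁ hr' (by omega)
        · exact not_succ hl.symm hs₁ hr₁ hs' (by omega)
      subst hab
      rw [ih hl hr₁ hs₁ (fun hi => hr' (List.infix_cons hi)) (fun hi => hs' (List.infix_cons hi))
        (by omega)]

theorem exists_reduced_evalWord_eq (w : List ℕ) (hw : ∀ i ∈ w, i ∈ ({0, 1, 3} : Set ℕ)) :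
    ∃ v : List ℕ, v.length = w.length ∧ (∀ i ∈ v, i ∈ ({0, 1, 3} : Set ℕ)) ∧
      ¬ [1, 0] <:+: v ∧ evalWord v = evalWord w := by
  induction w with
  | nil => exact ⟨[], rfl, by simp, by simp, rfl⟩
  | cons a w ih =>
    obtain ⟨v, hlen, hv, hred, heval⟩ := ih fun i hi => hw i (by simp [hi])
    rw [List.length_cons, evalWord_cons, ← heval, ← evalWord_cons, ← hlen]
    by_cases h10 : [1, 0] <+: a :: v
    · obtain ⟨t, ht⟩ := h10
      simp only [List.cons_append, List.nil_append, List.cons.injEq] at ht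
      obtain ⟨rfl, rfl⟩ := ht
      refine ⟨0 :: 3 :: t, rfl, ?_, ?_, (evalWord_one_zero_append t).symm⟩
      · simp_all
      · have ht : ¬ [1, 0] <:+: t := fun hi => hred (List.infix_cons hi)
        simp [List.infix_cons_iff, List.cons_prefix_cons, ht]
    · refine ⟨a :: v, rfl, ?_, ?_, rfl⟩
      · exact List.forall_mem_cons.2 ⟨hw a (by simp), hv⟩
      · rw [List.infix_cons_iff]
        exact not_or.2 ⟨h10, hred⟩

/-- For each `n`, evaluation of words is a bijection from the set of reduced words of
length `n` over `{0, 1, 3}` (those with no factor `10`) onto the set of all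
compositions of `n` maps from `{g₀, g₁, g₃}`: reduced words are unique representatives
for the semigroup. -/
theorem bijOn_reduced_words (n : ℕ) :
    Set.BijOn evalWord
      { w : List ℕ | w.length = n ∧ (∀ i ∈ w, i ∈ ({0, 1, 3} : Set ℕ)) ∧
          ¬ [1, 0] <:+: w }
      { f : ℝ → ℝ | ∃ w : List ℕ, w.length = n ∧ (∀ i ∈ w, i ∈ ({0, 1, 3} : Set ℕ)) ∧
          f = evalWord w } := by
  refine ⟨?_, ?_, ?_⟩
  · rintro w ⟨hlen, hw, -⟩
    exact ⟨w, hlen, hw, rfl⟩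
  · rintro u ⟨hu, hu₁, hu₂⟩ v ⟨hv, hv₁, hv₂⟩ h
    have h0 := congrFun h 0
    rw [evalWord_apply, evalWord_apply, hu, hv, div_left_inj' (by positivity), add_right_inj,
      mul_right_inj' three_ne_zero, Nat.cast_inj] at h0
    exact List.reverse_injective <| eq_of_ofDigits_three_eq (by simp [hu, hv])
      (by simpa using hu₁) (by simpa using hv₁)
      (fun hi => hu₂ (List.reverse_infix.1 hi)) (fun hi => hv₂ (List.reverse_infix.1 hi)) h0
  · rintro _ ⟨w, hlen, hw, rfl⟩
    obtain ⟨v, hv, hv₁, hv₂, heval⟩ := exists_reduced_evalWord_eq w hw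
    exact ⟨v, ⟨hv.trans hlen, hv₁, hv₂⟩, heval⟩
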